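/- For every multi-index length m there is a constant C such that for every w ∈ C_0^∞(ℝ_+×ℝ³), every product Γ^α of |α| ≤ m vector fields from Γ, every t ≥ 0 and x ∈ ℝ³: ⟨r⟩ |∂ Γ^α w(t,x)| ≤ C Σ_{|β|≤|α|+2} ‖Γ^β ∂w(t,·)‖_{L²(ℝ³)}. -/

import Mathlib

open MeasureTheory

noncomputable section

/-- The partial derivative in the `i`-th coordinate direction on `ℝⁿ`. -/
def pd {n : ℕ} (i : Fin n) (u : (Fin n → ℝ) → ℝ) : (Fin n → ℝ) → ℝ :=
  fun z => fderiv ℝ u z (Pi.single i 1)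

/-- Iterated application of a family of first-order operators along a list of indices. -/
def opIter {α γ : Type*} (F : α → γ → γ) : List α → γ → γ
  | [] => id
  | i :: L => fun u => F i (opIter F L u)

/-- The ten vector fields Γ on ℝ×ℝ³ (coordinates: `0 = t`, `1,2,3 = x`):
`∂_t, ∂_{x₁}, ∂_{x₂}, ∂_{x₃}`, the rotations `Ω_{jk} = x_j∂_k - x_k∂_j` (`1 ≤ j < k ≤ 3`)
and the boosts `Ω_{0k} = x_k∂_t + t∂_k` (`k = 1,2,3`). -/
def GammaField (i : Fin 10) (u : (Fin 4 → ℝ) → ℝ) : (Fin 4 → ℝ) → ℝ :=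
  if i.val = 0 then pd 0 u
  else if i.val = 1 then pd 1 u
  else if i.val = 2 then pd 2 u
  else if i.val = 3 then pd 3 u
  else if i.val = 4 then fun z => z 1 * pd 2 u z - z 2 * pd 1 u z
  else if i.val = 5 then fun z => z 1 * pd 3 u z - z 3 * pd 1 u z
  else if i.val = 6 then fun z => z 2 * pd 3 u z - z 3 * pd 2 u z
  else if i.val = 7 then fun z => z 1 * pd 0 u z + z 0 * pd 1 u z
  else if i.val = 8 then fun z => z 2 * pd 0 u z + z 0 * pd 2 u z
  else fun z => z 3 * pd 0 u z + z 0 * pd 3 u z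

/-- The spatial radius `r = |x|` of a space-time point. -/
def rad (z : Fin 4 → ℝ) : ℝ := Real.sqrt ((z 1)^2 + (z 2)^2 + (z 3)^2)

/-- The d'Alembertian `□ = ∂_t² - Δ` on ℝ×ℝ³. -/
def Box (u : (Fin 4 → ℝ) → ℝ) : (Fin 4 → ℝ) → ℝ :=
  fun z => pd 0 (pd 0 u) z - pd 1 (pd 1 u) z - pd 2 (pd 2 u) z - pd 3 (pd 3 u) z

/-- The `L²` norm in `x ∈ ℝ³` at fixed time `t`. -/
def L2x (f : (Fin 4 → ℝ) → ℝ) (t : ℝ) : ℝ :=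
  Real.sqrt (∫ x : Fin 3 → ℝ, (f (Fin.cons t x))^2)

/-- The linear part of the coefficient vector of the `a`-th field `GammaField a`. -/
def gammaMatrix (a : Fin 10) : Matrix (Fin 4) (Fin 4) ℝ :=
  ![0, 0, 0, 0,
    !![0, 0, 0, 0; 0, 0, -1, 0; 0, 1, 0, 0; 0, 0, 0, 0],
    !![0, 0, 0, 0; 0, 0, 0, -1; 0, 0, 0, 0; 0, 1, 0, 0],
    !![0, 0, 0, 0; 0, 0, 0, 0; 0, 0, 0, -1; 0, 0, 1, 0],
    !![0, 1, 0, 0; 1, 0, 0, 0; 0, 0, 0, 0; 0, 0, 0, 0],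
    !![0, 0, 1, 0; 0, 0, 0, 0; 1, 0, 0, 0; 0, 0, 0, 0],
    !![0, 0, 0, 1; 0, 0, 0, 0; 0, 0, 0, 0; 1, 0, 0, 0]] a

/-- The constant part of the coefficient vector of the `a`-th field `GammaField a`. -/
def gammaShift (a : Fin 10) : Fin 4 → ℝ :=
  ![![1, 0, 0, 0], ![0, 1, 0, 0], ![0, 0, 1, 0], ![0, 0, 0, 1], 0, 0, 0, 0, 0, 0] a

/-- The coefficient vector of the `a`-th field, an affine function of the space-time point. -/
def gammaVec (a : Fin 10) (z : Fin 4 → ℝ) : Fin 4 → ℝ :=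
  (gammaMatrix a).mulVecLin.toContinuousLinearMap z + gammaShift a

theorem fderiv_eq_sum_pd {n : ℕ} (u : (Fin n → ℝ) → ℝ) (z v : Fin n → ℝ) :
    fderiv ℝ u z v = ∑ i, v i * pd i u z := by
  conv_lhs => rw [← Finset.univ_sum_single v]
  rw [map_sum]
  refine Finset.sum_congr rfl fun i _ => ?_
  have : Pi.single i (v i) = v i • (Pi.single i 1 : Fin n → ℝ) := by
    rw [← Pi.single_smul]; simp
  rw [this, map_smul, smul_eq_mul, pd]

theorem GammaField_eq_fderiv (a : Fin 10) (u : (Fin 4 → ℝ) → ℝ) (z : Fin 4 → ℝ) :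
    GammaField a u z = fderiv ℝ u z (gammaVec a z) := by
  rw [fderiv_eq_sum_pd]
  fin_cases a <;>
    simp [GammaField, gammaVec, gammaMatrix, gammaShift, Fin.sum_univ_four,
      dotProduct] <;> ring

theorem contDiff_gammaVec (a : Fin 10) : ContDiff ℝ (⊤ : ℕ∞) (gammaVec a) := by
  unfold gammaVec
  exact (ContinuousLinearMap.contDiff _).add contDiff_const

theorem contDiff_pd {n : ℕ} {u : (Fin n → ℝ) → ℝ} (hu : ContDiff ℝ (⊤ : ℕ∞) u) (i : Fin n) :
    ContDiff ℝ (⊤ : ℕ∞) (pd i u) :=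
  (hu.fderiv_right (by simp)).clm_apply contDiff_const

theorem hasCompactSupport_pd {n : ℕ} {u : (Fin n → ℝ) → ℝ} (hu : HasCompactSupport u)
    (i : Fin n) : HasCompactSupport (pd i u) :=
  hu.fderiv_apply ℝ _

theorem contDiff_GammaField {u : (Fin 4 → ℝ) → ℝ} (hu : ContDiff ℝ (⊤ : ℕ∞) u) (a : Fin 10) :
    ContDiff ℝ (⊤ : ℕ∞) (GammaField a u) := by
  rw [funext (GammaField_eq_fderiv a u)]
  exact (hu.fderiv_right (by simp)).clm_apply (contDiff_gammaVec a)

theorem hasCompactSupport_GammaField {u : (Fin 4 → ℝ) → ℝ} (hu : HasCompactSupport u)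
    (a : Fin 10) : HasCompactSupport (GammaField a u) := by
  rw [funext (GammaField_eq_fderiv a u)]
  refine (hu.fderiv ℝ).mono' fun z hz => subset_closure ?_
  contrapose! hz
  simp only [Function.mem_support, not_not] at hz ⊢
  simp [hz]

theorem contDiff_opIter_GammaField {u : (Fin 4 → ℝ) → ℝ} (hu : ContDiff ℝ (⊤ : ℕ∞) u) :
    ∀ L : List (Fin 10), ContDiff ℝ (⊤ : ℕ∞) (opIter GammaField L u)
  | [] => hu
  | a :: L => contDiff_GammaField (contDiff_opIter_GammaField hu L) a

theorem hasCompactSupport_opIter_GammaField {u : (Fin 4 → ℝ) → ℝ} (hu : HasCompactSupport u) :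
    ∀ L : List (Fin 10), HasCompactSupport (opIter GammaField L u)
  | [] => hu
  | a :: L => hasCompactSupport_GammaField (hasCompactSupport_opIter_GammaField hu L) a

theorem opIter_append {α γ : Type*} (F : α → γ → γ) (A B : List α) (u : γ) :
    opIter F (A ++ B) u = opIter F A (opIter F B u) := by
  induction A with
  | nil => rfl
  | cons a A ih => exact congrArg (F a) ih

theorem GammaField_add_smul {u v : (Fin 4 → ℝ) → ℝ} (hu : ContDiff ℝ (⊤ : ℕ∞) u)
    (hv : ContDiff ℝ (⊤ : ℕ∞) v) (ε : ℝ) (a : Fin 10) :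
    GammaField a (u + ε • v) = GammaField a u + ε • GammaField a v := by
  ext z
  have hu' : DifferentiableAt ℝ u z := hu.differentiable (by simp) z
  have hv' : DifferentiableAt ℝ v z := hv.differentiable (by simp) z
  simp only [Pi.add_apply, Pi.smul_apply, GammaField_eq_fderiv]
  rw [fderiv_add hu' (hv'.const_smul ε), fderiv_const_smul hv']
  simp

theorem opIter_GammaField_add_smul {u v : (Fin 4 → ℝ) → ℝ} (hu : ContDiff ℝ (⊤ : ℕ∞) u)
    (hv : ContDiff ℝ (⊤ : ℕ∞) v) (ε : ℝ) (A : List (Fin 10)) :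
    opIter GammaField A (u + ε • v) = opIter GammaField A u + ε • opIter GammaField A v := by
  induction A with
  | nil => rfl
  | cons a A ih =>
    change GammaField a (opIter GammaField A (u + ε • v)) = _
    rw [ih, GammaField_add_smul (contDiff_opIter_GammaField hu A)
      (contDiff_opIter_GammaField hv A)]
    rfl

theorem exists_gammaMatrix_mulVec_single (a : Fin 10) (i : Fin 4) :
    ∃ (ε : ℝ) (j : Fin 4), |ε| ≤ 1 ∧
      (gammaMatrix a).mulVec (Pi.single i 1) = ε • (Pi.single j 1 : Fin 4 → ℝ) := by
  have zero_case : (gammaMatrix a).col i = 0 → ∃ (ε : ℝ) (j : Fin 4), |ε| ≤ 1 ∧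
      (gammaMatrix a).col i = ε • (Pi.single j 1 : Fin 4 → ℝ) :=
    fun h => ⟨0, 0, by simp, by simp [h]⟩
  have pos_case (j : Fin 4) : (gammaMatrix a).col i = Pi.single j 1 →
      ∃ (ε : ℝ) (j : Fin 4), |ε| ≤ 1 ∧
      (gammaMatrix a).col i = ε • (Pi.single j 1 : Fin 4 → ℝ) :=
    fun h => ⟨1, j, by simp, by simp [h]⟩
  have neg_case (j : Fin 4) : (gammaMatrix a).col i = -Pi.single j 1 →
      ∃ (ε : ℝ) (j : Fin 4), |ε| ≤ 1 ∧
      (gammaMatrix a).col i = ε • (Pi.single j 1 : Fin 4 → ℝ) :=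
    fun h => ⟨-1, j, by simp, by simp [h]⟩
  rw [Matrix.mulVec_single_one]
  fin_cases a <;> fin_cases i <;>
  first
  | (refine zero_case ?_; ext k; fin_cases k <;> simp [gammaMatrix]; done)
  | (refine pos_case 0 ?_; ext k; fin_cases k <;> simp [gammaMatrix]; done)
  | (refine pos_case 1 ?_; ext k; fin_cases k <;> simp [gammaMatrix]; done)
  | (refine pos_case 2 ?_; ext k; fin_cases k <;> simp [gammaMatrix]; done)
  | (refine pos_case 3 ?_; ext k; fin_cases k <;> simp [gammaMatrix]; done)
  | (refine neg_case 1 ?_; ext k; fin_cases k <;> simp [gammaMatrix]; done)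
  | (refine neg_case 2 ?_; ext k; fin_cases k <;> simp [gammaMatrix])

/-- The commutator of a coordinate derivative with a field of `Γ` is zero or, up to sign, a
coordinate derivative. -/
theorem exists_pd_GammaField (a : Fin 10) (i : Fin 4) :
    ∃ (ε : ℝ) (j : Fin 4), |ε| ≤ 1 ∧ ∀ u : (Fin 4 → ℝ) → ℝ, ContDiff ℝ (⊤ : ℕ∞) u →
      pd i (GammaField a u) = GammaField a (pd i u) + ε • pd j u := by
  obtain ⟨ε, j, hε, h⟩ := exists_gammaMatrix_mulVec_single a i
  refine ⟨ε, j, hε, fun u hu => funext fun z => ?_⟩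
  have hd : DifferentiableAt ℝ (fderiv ℝ u) z :=
    (hu.fderiv_right (m := (⊤ : ℕ∞)) (by simp)).differentiable (by simp) z
  have hV : HasFDerivAt (gammaVec a) (gammaMatrix a).mulVecLin.toContinuousLinearMap z :=
    (ContinuousLinearMap.hasFDerivAt _).add_const _
  have hG := hd.hasFDerivAt.clm_apply hV
  rw [← funext (GammaField_eq_fderiv a u)] at hG
  have hp :=
    hd.hasFDerivAt.clm_apply (hasFDerivAt_const (Pi.single i 1) z)
  have symm : IsSymmSndFDerivAt ℝ u z :=
    hu.contDiffAt.isSymmSndFDerivAt (by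
      simpa using WithTop.coe_le_coe.2 (le_top : (2 : ℕ∞) ≤ ⊤))
  simp only [Pi.add_apply, Pi.smul_apply]
  rw [pd, hG.fderiv, GammaField_eq_fderiv, show fderiv ℝ (pd i u) z = _ from hp.fderiv]
  simp only [add_apply, ContinuousLinearMap.coe_comp,
    Function.comp_apply, ContinuousLinearMap.flip_apply, LinearMap.coe_toContinuousLinearMap',
    Matrix.mulVecLin_apply, h, map_smul, smul_eq_mul, pd]
  rw [symm (Pi.single i 1)]
  simp [add_comm]

theorem continuous_finCons (t : ℝ) :
    Continuous fun x : Fin 3 → ℝ => (Fin.cons t x : Fin 4 → ℝ) :=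
  Continuous.finCons continuous_const continuous_id

theorem isClosedEmbedding_finCons (t : ℝ) :
    Topology.IsClosedEmbedding fun x : Fin 3 → ℝ => (Fin.cons t x : Fin 4 → ℝ) := by
  refine Topology.IsClosedEmbedding.of_continuous_injective_isClosedMap (continuous_finCons t)
    (fun _ _ h => Fin.cons_right_injective (α := fun _ => ℝ) t h) fun S hS => ?_
  have h : (fun x : Fin 3 → ℝ => (Fin.cons t x : Fin 4 → ℝ)) '' S =
      {z | z 0 = t} ∩ (fun z : Fin 4 → ℝ => Fin.tail z) ⁻¹' S := by
    ext z
    constructor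
    · rintro ⟨x, hx, rfl⟩
      simpa using hx
    · rintro ⟨h0, hz⟩
      exact ⟨Fin.tail z, hz, by simp only [← show z 0 = t from h0, Fin.cons_self_tail]⟩
  rw [h]
  exact (isClosed_eq (continuous_apply 0) continuous_const).inter
    (hS.preimage (continuous_pi fun i => continuous_apply _))

theorem memLp_slice {f : (Fin 4 → ℝ) → ℝ} (hf : Continuous f) (hs : HasCompactSupport f)
    (t : ℝ) : MemLp (fun x : Fin 3 → ℝ => f (Fin.cons t x)) 2 volume :=
  (hf.comp (continuous_finCons t)).memLp_of_hasCompactSupport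
    (hs.comp_isClosedEmbedding (isClosedEmbedding_finCons t))

theorem L2x_eq_eLpNorm {f : (Fin 4 → ℝ) → ℝ} (hf : Continuous f) (hs : HasCompactSupport f)
    (t : ℝ) :
    ENNReal.ofReal (L2x f t) = eLpNorm (fun x : Fin 3 → ℝ => f (Fin.cons t x)) 2 volume := by
  rw [(memLp_slice hf hs t).eLpNorm_eq_integral_rpow_norm (by simp) (by simp), L2x,
    Real.sqrt_eq_rpow]
  norm_num

theorem L2x_nonneg (f : (Fin 4 → ℝ) → ℝ) (t : ℝ) : 0 ≤ L2x f t := Real.sqrt_nonneg _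

theorem L2x_add_smul_le {f g : (Fin 4 → ℝ) → ℝ} (hf : Continuous f) (hfs : HasCompactSupport f)
    (hg : Continuous g) (hgs : HasCompactSupport g) {ε : ℝ} (hε : |ε| ≤ 1) (t : ℝ) :
    L2x (f + ε • g) t ≤ L2x f t + L2x g t := by
  rw [← ENNReal.ofReal_le_ofReal_iff (add_nonneg (L2x_nonneg _ _) (L2x_nonneg _ _)),
    ENNReal.ofReal_add (L2x_nonneg _ _) (L2x_nonneg _ _), L2x_eq_eLpNorm hf hfs,
    L2x_eq_eLpNorm hg hgs,
    L2x_eq_eLpNorm (hf.add (hg.const_smul ε)) (hfs.add (hgs.smul_left (f := fun _ => ε)))]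
  have hF := (memLp_slice hf hfs t).aestronglyMeasurable
  have hG := (memLp_slice hg hgs t).aestronglyMeasurable
  refine (eLpNorm_add_le hF (hG.const_smul ε) (by norm_num)).trans ?_
  gcongr
  rw [eLpNorm_const_smul]
  refine mul_le_of_le_one_left' ?_
  rw [Real.enorm_eq_ofReal_abs]
  exact ENNReal.ofReal_le_one.2 hε

/-- The sum of the norms `‖Γ^β f_j‖` over all `|β| < N` and all members `f_j` of a family. -/
def gammaEnergy {ι : Type*} [Fintype ι] (N : ℕ) (f : ι → (Fin 4 → ℝ) → ℝ) (t : ℝ) : ℝ :=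
  ∑ n ∈ Finset.range N, ∑ σ : Fin n → Fin 10, ∑ j, L2x (opIter GammaField (List.ofFn σ) (f j)) t

theorem L2x_opIter_le_gammaEnergy {ι : Type*} [Fintype ι] {N : ℕ} (f : ι → (Fin 4 → ℝ) → ℝ)
    (t : ℝ) {A : List (Fin 10)} (hA : A.length < N) (j : ι) :
    L2x (opIter GammaField A (f j)) t ≤ gammaEnergy N f t := by
  have key : L2x (opIter GammaField (List.ofFn A.get) (f j)) t ≤ gammaEnergy N f t := by
    refine le_trans ?_ (Finset.single_le_sum (f := fun n => ∑ σ : Fin n → Fin 10, ∑ j,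
      L2x (opIter GammaField (List.ofFn σ) (f j)) t)
      (fun n _ => Finset.sum_nonneg fun σ _ => Finset.sum_nonneg fun j _ => L2x_nonneg _ _)
      (Finset.mem_range.2 hA))
    refine le_trans ?_ (Finset.single_le_sum (f := fun σ : Fin A.length → Fin 10 => ∑ j,
      L2x (opIter GammaField (List.ofFn σ) (f j)) t)
      (fun σ _ => Finset.sum_nonneg fun j _ => L2x_nonneg _ _) (Finset.mem_univ A.get))
    exact Finset.single_le_sum (f := fun j =>
      L2x (opIter GammaField (List.ofFn A.get) (f j)) t)
      (fun j _ => L2x_nonneg _ _) (Finset.mem_univ j)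
  rwa [List.ofFn_get] at key

/-- Moving a coordinate derivative through a product of fields of `Γ`, in the energy norm. -/
theorem L2x_opIter_pd_opIter_le {w : (Fin 4 → ℝ) → ℝ} (hw : ContDiff ℝ (⊤ : ℕ∞) w)
    (hs : HasCompactSupport w) (t : ℝ) (N : ℕ) (L : List (Fin 10)) :
    ∀ (A : List (Fin 10)) (i : Fin 4), A.length + L.length < N →
      L2x (opIter GammaField A (pd i (opIter GammaField L w))) t ≤
        2 ^ L.length * gammaEnergy N (fun j => pd j w) t := by
  induction L with
  | nil =>
    intro A i hA
    simpa [opIter] using L2x_opIter_le_gammaEnergy (fun j => pd j w) t (by simpa using hA) i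
  | cons a L ih =>
    intro A i hA
    simp only [List.length_cons] at hA ⊢
    obtain ⟨ε, j, hε, hcomm⟩ := exists_pd_GammaField a i
    have hu := contDiff_opIter_GammaField hw L
    have hus := hasCompactSupport_opIter_GammaField hs L
    have e : opIter GammaField A (pd i (opIter GammaField (a :: L) w)) =
        opIter GammaField (A ++ [a]) (pd i (opIter GammaField L w)) +
          ε • opIter GammaField A (pd j (opIter GammaField L w)) := by
      rw [opIter_append]
      change opIter GammaField A (pd i (GammaField a (opIter GammaField L w))) = _
      rw [hcomm _ hu, opIter_GammaField_add_smul (contDiff_GammaField (contDiff_pd hu i) a)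
        (contDiff_pd hu j)]
      rfl
    rw [e]
    refine (L2x_add_smul_le (contDiff_opIter_GammaField (contDiff_pd hu i) _).continuous
      (hasCompactSupport_opIter_GammaField (hasCompactSupport_pd hus i) _)
      (contDiff_opIter_GammaField (contDiff_pd hu j) _).continuous
      (hasCompactSupport_opIter_GammaField (hasCompactSupport_pd hus j) _) hε t).trans ?_
    have h1 := ih (A ++ [a]) i (by simp; lia)
    have h2 := ih A j (by lia)
    rw [pow_succ]
    linarith

theorem eq_integral_of_hasDerivAt_two {f f₁ f₂ : ℝ → ℝ} (h₁ : ∀ ρ, HasDerivAt f (f₁ ρ) ρ)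
    (h₂ : ∀ ρ, HasDerivAt f₁ (f₂ ρ) ρ) (hc : Continuous f₂) :
    f 0 = ∫ ρ in (0 : ℝ)..1, ρ * (2 * f ρ - 4 * (1 - ρ) * f₁ ρ + (1 - ρ) ^ 2 * f₂ ρ) := by
  have hf : Continuous f := continuous_iff_continuousAt.2 fun ρ => (h₁ ρ).continuousAt
  have hf₁ : Continuous f₁ := continuous_iff_continuousAt.2 fun ρ => (h₂ ρ).continuousAt
  have key : ∀ ρ : ℝ, HasDerivAt
      (fun ρ => ρ * ((1 - ρ) ^ 2 * f₁ ρ - 2 * (1 - ρ) * f ρ) - (1 - ρ) ^ 2 * f ρ)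
      (ρ * (2 * f ρ - 4 * (1 - ρ) * f₁ ρ + (1 - ρ) ^ 2 * f₂ ρ)) ρ := by
    intro ρ
    have hl : HasDerivAt (fun ρ : ℝ => 1 - ρ) (-1) ρ := (hasDerivAt_id ρ).const_sub 1
    have h := ((hasDerivAt_id ρ).mul (((hl.pow 2).mul (h₂ ρ)).sub
      ((hl.const_mul 2).mul (h₁ ρ)))).sub ((hl.pow 2).mul (h₁ ρ))
    refine h.congr_deriv ?_
    simp
    ring
  rw [intervalIntegral.integral_eq_sub_of_hasDerivAt (fun ρ _ => key ρ)
    (Continuous.intervalIntegrable (by fun_prop) _ _)]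
  simp

theorem abs_cutoff_combination_le {K ρ f₀ f₁ f₂ S₁ S₂ : ℝ} (hK : 1 ≤ K)
    (hρ : ρ ∈ Set.Icc (0 : ℝ) 1) (hS₁ : 0 ≤ S₁) (hS₂ : 0 ≤ S₂) (b₁ : |f₁| ≤ K * S₁)
    (b₂ : |f₂| ≤ K * S₁ + K * (K * S₂)) :
    |2 * f₀ - 4 * (1 - ρ) * f₁ + (1 - ρ) ^ 2 * f₂| ≤ 5 * K ^ 2 * (|f₀| + S₁ + S₂) := by
  have q1 : |1 - ρ| ≤ 1 := by rw [abs_le]; constructor <;> linarith [hρ.1, hρ.2]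
  have q2 : |1 - ρ| ^ 2 ≤ 1 := pow_le_one₀ (abs_nonneg _) q1
  have r1 : |1 - ρ| * |f₁| ≤ K * S₁ := by
    simpa using mul_le_mul q1 b₁ (abs_nonneg _) zero_le_one
  have r2 : |1 - ρ| ^ 2 * |f₂| ≤ K * S₁ + K * (K * S₂) := by
    simpa using mul_le_mul q2 b₂ (abs_nonneg _) zero_le_one
  have k1 : K ≤ K ^ 2 := by nlinarith
  have k2 : K * S₁ ≤ K ^ 2 * S₁ := mul_le_mul_of_nonneg_right k1 hS₁
  have k3 : |f₀| ≤ K ^ 2 * |f₀| := le_mul_of_one_le_left (abs_nonneg _) (by nlinarith)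
  have k4 : 0 ≤ K ^ 2 * S₂ := by positivity
  calc |2 * f₀ - 4 * (1 - ρ) * f₁ + (1 - ρ) ^ 2 * f₂|
      ≤ |2 * f₀| + |4 * (1 - ρ) * f₁| + |(1 - ρ) ^ 2 * f₂| :=
        (abs_add_le _ _).trans (add_le_add_left (abs_sub _ _) _)
    _ = 2 * |f₀| + 4 * (|1 - ρ| * |f₁|) + |1 - ρ| ^ 2 * |f₂| := by
        simp only [abs_mul, abs_pow, Nat.abs_ofNat]; ring
    _ ≤ 5 * K ^ 2 * (|f₀| + S₁ + S₂) := by linarith [abs_nonneg f₀]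

theorem sum_enorm_opIter_GammaField (u : (Fin 4 → ℝ) → ℝ) (z : Fin 4 → ℝ) :
    (∑ n ∈ Finset.range 3, ∑ σ : Fin n → Fin 10, ‖opIter GammaField (List.ofFn σ) u z‖ₑ) =
      ENNReal.ofReal (|u z| + ∑ a, |GammaField a u z| +
        ∑ a, ∑ b, |GammaField b (GammaField a u) z|) := by
  have h2 : ∀ g : (Fin 2 → Fin 10) → ENNReal, ∑ σ, g σ = ∑ a, ∑ b, g ![b, a] := by
    intro g
    rw [← (finTwoArrowEquiv (Fin 10)).symm.sum_comp, Fintype.sum_prod_type, Finset.sum_comm]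
    rfl
  have h1 : ∀ g : (Fin 1 → Fin 10) → ENNReal, ∑ σ, g σ = ∑ a, g ![a] := by
    intro g
    rw [← (Equiv.funUnique (Fin 1) (Fin 10)).symm.sum_comp]
    refine Finset.sum_congr rfl fun a _ => congrArg g ?_
    ext k
    simp [Subsingleton.elim k 0]
  rw [ENNReal.ofReal_add (by positivity) (by positivity),
    ENNReal.ofReal_add (by positivity) (by positivity),
    ENNReal.ofReal_sum_of_nonneg (fun _ _ => by positivity),
    ENNReal.ofReal_sum_of_nonneg (fun _ _ => by positivity)]
  simp only [Finset.sum_range_succ, Finset.sum_range_zero, h1, h2, zero_add]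
  congr 2
  · simp [opIter, Real.enorm_eq_ofReal_abs]
  · refine Finset.sum_congr rfl fun a _ => ?_
    simp [opIter, Real.enorm_eq_ofReal_abs]
  · funext a
    rw [ENNReal.ofReal_sum_of_nonneg (fun _ _ => by positivity)]
    refine Finset.sum_congr rfl fun b _ => ?_
    simp [opIter, Real.enorm_eq_ofReal_abs]

/-- If derivatives along the curve `y` are combinations of the fields `Γ` with controlled
coefficients, a value at `y 0` is controlled by a weighted integral along `y`. -/
theorem enorm_le_lintegral_curve {y : ℝ → Fin 4 → ℝ} {c c' : Fin 10 → ℝ → ℝ} {K : ℝ} (hK : 1 ≤ K)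
    (hy : ∀ u : (Fin 4 → ℝ) → ℝ, ContDiff ℝ (⊤ : ℕ∞) u → ∀ ρ,
      HasDerivAt (fun ρ => u (y ρ)) (∑ a, c a ρ * GammaField a u (y ρ)) ρ)
    (hyc : Continuous y)
    (hc : ∀ a ρ, HasDerivAt (c a) (c' a ρ) ρ) (hc' : ∀ a, Continuous (c' a))
    (hcK : ∀ a, ∀ ρ ∈ Set.Icc (0 : ℝ) 1, |c a ρ| ≤ K)
    (hcK' : ∀ a, ∀ ρ ∈ Set.Icc (0 : ℝ) 1, |c' a ρ| ≤ K)
    {u : (Fin 4 → ℝ) → ℝ} (hu : ContDiff ℝ (⊤ : ℕ∞) u) :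
    ‖u (y 0)‖ₑ ≤ ∫⁻ ρ in Set.Ioc (0 : ℝ) 1, ENNReal.ofReal (5 * K ^ 2) * (ENNReal.ofReal ρ *
      ∑ n ∈ Finset.range 3, ∑ σ : Fin n → Fin 10,
        ‖opIter GammaField (List.ofFn σ) u (y ρ)‖ₑ) := by
  have hΓ := contDiff_GammaField hu
  have hΓΓ := fun a b => contDiff_GammaField (hΓ a) b
  have hcc : ∀ a, Continuous (c a) := fun a =>
    continuous_iff_continuousAt.2 fun ρ => (hc a ρ).continuousAt
  have e := eq_integral_of_hasDerivAt_two (hy u hu)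
    (f₂ := fun ρ => ∑ a, (c' a ρ * GammaField a u (y ρ) +
      c a ρ * ∑ b, c b ρ * GammaField b (GammaField a u) (y ρ)))
    (fun ρ => HasDerivAt.fun_sum fun a _ => (hc a ρ).mul (hy _ (hΓ a) ρ)) (by
      refine continuous_finsetSum _ fun a _ => ?_
      refine ((hc' a).mul ((hΓ a).continuous.comp hyc)).add ((hcc a).mul ?_)
      exact continuous_finsetSum _ fun b _ =>
        (hcc b).mul ((hΓΓ a b).continuous.comp hyc))
  rw [e, intervalIntegral.integral_of_le zero_le_one]
  refine (enorm_integral_le_lintegral_enorm _).trans ?_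
  refine setLIntegral_mono_ae' measurableSet_Ioc (Filter.Eventually.of_forall fun ρ hρ => ?_)
  have hρI : ρ ∈ Set.Icc (0 : ℝ) 1 := Set.Ioc_subset_Icc_self hρ
  rw [sum_enorm_opIter_GammaField, ← ENNReal.ofReal_mul hρ.1.le, ← ENNReal.ofReal_mul (by positivity),
    Real.enorm_eq_ofReal_abs]
  refine ENNReal.ofReal_le_ofReal ?_
  rw [abs_mul, abs_of_pos hρ.1, mul_left_comm]
  refine mul_le_mul_of_nonneg_left ?_ hρ.1.le
  have hK0 : 0 ≤ K := by linarith
  refine abs_cutoff_combination_le hK hρI (Finset.sum_nonneg fun _ _ => abs_nonneg _)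
    (Finset.sum_nonneg fun _ _ => Finset.sum_nonneg fun _ _ => abs_nonneg _) ?_ ?_
  · rw [Finset.mul_sum]
    refine (Finset.abs_sum_le_sum_abs _ _).trans (Finset.sum_le_sum fun a _ => ?_)
    rw [abs_mul]
    exact mul_le_mul_of_nonneg_right (hcK a ρ hρI) (abs_nonneg _)
  · rw [Finset.mul_sum, Finset.mul_sum, Finset.mul_sum, ← Finset.sum_add_distrib]
    refine (Finset.abs_sum_le_sum_abs _ _).trans (Finset.sum_le_sum fun a _ => ?_)
    refine (abs_add_le _ _).trans (add_le_add ?_ ?_)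
    · rw [abs_mul]
      exact mul_le_mul_of_nonneg_right (hcK' a ρ hρI) (abs_nonneg _)
    · rw [abs_mul]
      refine mul_le_mul (hcK a ρ hρI) ?_ (abs_nonneg _) hK0
      rw [Finset.mul_sum]
      refine (Finset.abs_sum_le_sum_abs _ _).trans (Finset.sum_le_sum fun b _ => ?_)
      rw [abs_mul]
      exact mul_le_mul_of_nonneg_right (hcK b ρ hρI) (abs_nonneg _)

theorem setLIntegral_enorm_comp_le {E : Type*} [NormedAddCommGroup E] [NormedSpace ℝ E]
    [FiniteDimensional ℝ E] [MeasurableSpace E] [BorelSpace E] {μ : Measure E}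
    [μ.IsAddHaarMeasure] {Q : Set E} (hQ : MeasurableSet Q) (hQ1 : μ Q ≤ 1)
    {Φ : E → E} {D : E → E →L[ℝ] E} (hD : ∀ h ∈ Q, HasFDerivAt Φ (D h) h) (hinj : Set.InjOn Φ Q)
    {κ : ℝ} (hκ : 0 < κ) (hdet : ∀ h ∈ Q, κ ≤ |(D h).det|) {g : E → ℝ} (hg : Continuous g) :
    ∫⁻ h in Q, ‖g (Φ h)‖ₑ ∂μ ≤ ENNReal.ofReal (1 / √κ) * eLpNorm g 2 μ := by
  have hmeas : AEStronglyMeasurable (fun h => g (Φ h)) (μ.restrict Q) := by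
    refine ContinuousOn.aestronglyMeasurable (fun h hh => ?_) hQ
    exact (hg.continuousAt.comp (hD h hh).continuousAt).continuousWithinAt
  have cv := lintegral_image_eq_lintegral_abs_det_fderiv_mul μ hQ
    (fun h hh => (hD h hh).hasFDerivWithinAt) hinj (fun z => ‖g z‖ₑ ^ (2 : ℝ))
  have J : ENNReal.ofReal κ * ∫⁻ h in Q, ‖g (Φ h)‖ₑ ^ (2 : ℝ) ∂μ ≤ ∫⁻ z, ‖g z‖ₑ ^ (2 : ℝ) ∂μ := by
    calc ENNReal.ofReal κ * ∫⁻ h in Q, ‖g (Φ h)‖ₑ ^ (2 : ℝ) ∂μ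
        = ∫⁻ h in Q, ENNReal.ofReal κ * ‖g (Φ h)‖ₑ ^ (2 : ℝ) ∂μ :=
          (lintegral_const_mul'' _ (hmeas.enorm.pow_const _)).symm
      _ ≤ ∫⁻ h in Q, ENNReal.ofReal |(D h).det| * ‖g (Φ h)‖ₑ ^ (2 : ℝ) ∂μ := by
          refine setLIntegral_mono_ae' hQ (Filter.Eventually.of_forall fun h hh => ?_)
          gcongr
          exact hdet h hh
      _ = ∫⁻ z in Φ '' Q, ‖g z‖ₑ ^ (2 : ℝ) ∂μ := cv.symm
      _ ≤ ∫⁻ z, ‖g z‖ₑ ^ (2 : ℝ) ∂μ := setLIntegral_le_lintegral _ _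
  have J' : ∫⁻ h in Q, ‖g (Φ h)‖ₑ ^ (2 : ℝ) ∂μ ≤
      ENNReal.ofReal (1 / κ) * ∫⁻ z, ‖g z‖ₑ ^ (2 : ℝ) ∂μ := by
    calc ∫⁻ h in Q, ‖g (Φ h)‖ₑ ^ (2 : ℝ) ∂μ
        = ENNReal.ofReal (1 / κ) * (ENNReal.ofReal κ * ∫⁻ h in Q, ‖g (Φ h)‖ₑ ^ (2 : ℝ) ∂μ) := by
          rw [← mul_assoc, ← ENNReal.ofReal_mul (by positivity), one_div_mul_cancel hκ.ne']
          simp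
      _ ≤ _ := by gcongr
  calc ∫⁻ h in Q, ‖g (Φ h)‖ₑ ∂μ = eLpNorm (fun h => g (Φ h)) 1 (μ.restrict Q) :=
        eLpNorm_one_eq_lintegral_enorm.symm
    _ ≤ eLpNorm (fun h => g (Φ h)) 2 (μ.restrict Q) * μ.restrict Q Set.univ ^
          (1 / (1 : ENNReal).toReal - 1 / (2 : ENNReal).toReal) :=
        eLpNorm_le_eLpNorm_mul_rpow_measure_univ (by norm_num) hmeas
    _ ≤ eLpNorm (fun h => g (Φ h)) 2 (μ.restrict Q) * 1 := by
        gcongr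
        rw [Measure.restrict_apply_univ]
        exact ENNReal.rpow_le_one hQ1 (by norm_num)
    _ = (∫⁻ h in Q, ‖g (Φ h)‖ₑ ^ (2 : ℝ) ∂μ) ^ (1 / (2 : ℝ)) := by
        rw [mul_one, eLpNorm_eq_lintegral_rpow_enorm_toReal (by norm_num) (by norm_num)]
        simp
    _ ≤ (ENNReal.ofReal (1 / κ) * ∫⁻ z, ‖g z‖ₑ ^ (2 : ℝ) ∂μ) ^ (1 / (2 : ℝ)) := by gcongr
    _ = ENNReal.ofReal (1 / √κ) * eLpNorm g 2 μ := by
        rw [ENNReal.mul_rpow_of_nonneg _ _ (by norm_num),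
          ENNReal.ofReal_rpow_of_nonneg (by positivity) (by norm_num),
          eLpNorm_eq_lintegral_rpow_enorm_toReal (by norm_num) (by norm_num), ← Real.sqrt_eq_rpow,
          Real.sqrt_div zero_le_one, Real.sqrt_one]
        simp

theorem lintegral_ofReal_rpow_neg_half :
    ∫⁻ ρ in Set.Ioc (0 : ℝ) 1, ENNReal.ofReal (ρ ^ (-(1 / 2) : ℝ)) = ENNReal.ofReal 2 := by
  have hi : IntervalIntegrable (fun ρ : ℝ => ρ ^ (-(1 / 2) : ℝ)) volume 0 1 :=
    intervalIntegral.intervalIntegrable_rpow' (by norm_num)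
  rw [← ofReal_integral_eq_lintegral_ofReal
    ((intervalIntegrable_iff_integrableOn_Ioc_of_le zero_le_one).1 hi),
    ← intervalIntegral.integral_of_le zero_le_one, integral_rpow (Or.inl (by norm_num))]
  · norm_num
  · exact (ae_restrict_iff' measurableSet_Ioc).2 (Filter.Eventually.of_forall fun ρ hρ =>
      Real.rpow_nonneg hρ.1.le _)

/-- The parameter cube of the charts. -/
def chartCube : Set (Fin 3 → ℝ) := Set.Icc 0 fun _ => 1 / 4

theorem volume_chartCube : volume chartCube = ENNReal.ofReal (1 / 64) := by
  rw [chartCube, Real.volume_Icc_pi, ← ENNReal.ofReal_prod_of_nonneg (by norm_num)]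
  norm_num

/-- A pointwise bound from a chart `Y` swept out by curves `Y h` starting at `x` along which
derivatives are combinations of the fields `Γ`. -/
theorem abs_le_gammaEnergy_of_chart {K κ t : ℝ} (hK : 1 ≤ K) (hκ : 0 < κ) {x : Fin 3 → ℝ}
    {Y : (Fin 3 → ℝ) → ℝ → Fin 3 → ℝ} {c c' : (Fin 3 → ℝ) → Fin 10 → ℝ → ℝ}
    {D : (Fin 3 → ℝ) → ℝ → (Fin 3 → ℝ) →L[ℝ] (Fin 3 → ℝ)}
    (hY0 : ∀ h, Y h 0 = x) (hYc : Continuous (Function.uncurry Y))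
    (hy : ∀ h, ∀ u : (Fin 4 → ℝ) → ℝ, ContDiff ℝ (⊤ : ℕ∞) u → ∀ ρ,
      HasDerivAt (fun ρ => u (Fin.cons t (Y h ρ)))
        (∑ a, c h a ρ * GammaField a u (Fin.cons t (Y h ρ))) ρ)
    (hc : ∀ h a ρ, HasDerivAt (c h a) (c' h a ρ) ρ) (hc' : ∀ h a, Continuous (c' h a))
    (hcK : ∀ h ∈ chartCube, ∀ a, ∀ ρ ∈ Set.Icc (0 : ℝ) 1, |c h a ρ| ≤ K)
    (hcK' : ∀ h ∈ chartCube, ∀ a, ∀ ρ ∈ Set.Icc (0 : ℝ) 1, |c' h a ρ| ≤ K)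
    (hD : ∀ h ρ, HasFDerivAt (fun h => Y h ρ) (D h ρ) h)
    (hinj : ∀ ρ ∈ Set.Ioc (0 : ℝ) 1, Set.InjOn (fun h => Y h ρ) chartCube)
    (hdet : ∀ ρ ∈ Set.Ioc (0 : ℝ) 1, ∀ h ∈ chartCube, κ * ρ ^ 3 ≤ |(D h ρ).det|)
    {u : (Fin 4 → ℝ) → ℝ} (hu : ContDiff ℝ (⊤ : ℕ∞) u) (hs : HasCompactSupport u) :
    |u (Fin.cons t x)| ≤ 640 * K ^ 2 / √κ * gammaEnergy 3 (fun _ : Unit => u) t := by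
  have hQ : MeasurableSet chartCube := measurableSet_Icc
  have hsm := contDiff_opIter_GammaField hu
  have hsc := hasCompactSupport_opIter_GammaField hs
  have curve : ∀ h ∈ chartCube, ‖u (Fin.cons t x)‖ₑ ≤ ∫⁻ ρ in Set.Ioc (0 : ℝ) 1,
      ENNReal.ofReal (5 * K ^ 2) * (ENNReal.ofReal ρ * ∑ n ∈ Finset.range 3,
        ∑ σ : Fin n → Fin 10, ‖opIter GammaField (List.ofFn σ) u (Fin.cons t (Y h ρ))‖ₑ) := by
    intro h hh
    have hYh : Continuous (Y h) := hYc.comp (Continuous.prodMk_right h)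
    have := enorm_le_lintegral_curve (y := fun ρ => Fin.cons t (Y h ρ)) hK (hy h)
      ((continuous_finCons t).comp hYh) (hc h) (hc' h) (hcK h hh) (hcK' h hh) hu
    simpa only [hY0] using this
  have slice : ∀ ρ ∈ Set.Ioc (0 : ℝ) 1, ∀ A : List (Fin 10),
      ∫⁻ h in chartCube, ‖opIter GammaField A u (Fin.cons t (Y h ρ))‖ₑ ≤
        ENNReal.ofReal (1 / √(κ * ρ ^ 3) * L2x (opIter GammaField A u) t) := by
    intro ρ hρ A
    have hρ0 := hρ.1
    rw [ENNReal.ofReal_mul (by positivity), L2x_eq_eLpNorm (hsm A).continuous (hsc A)]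
    exact setLIntegral_enorm_comp_le hQ (by rw [volume_chartCube]; norm_num)
      (fun h _ => hD h ρ) (hinj ρ hρ) (by positivity) (hdet ρ hρ)
      ((hsm A).continuous.comp (continuous_finCons t))
  have meas : ∀ A : List (Fin 10), Measurable fun p : (Fin 3 → ℝ) × ℝ =>
      ‖opIter GammaField A u (Fin.cons t (Y p.1 p.2))‖ₑ := fun A =>
    ((hsm A).continuous.comp ((continuous_finCons t).comp hYc)).measurable.enorm
  have measρ : ∀ (A : List (Fin 10)) (ρ : ℝ), Measurable fun h : Fin 3 → ℝ =>
      ‖opIter GammaField A u (Fin.cons t (Y h ρ))‖ₑ := fun A ρ =>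
    (meas A).comp measurable_prodMk_right
  have measSum : Measurable fun p : (Fin 3 → ℝ) × ℝ => ∑ n ∈ Finset.range 3,
      ∑ σ : Fin n → Fin 10, ‖opIter GammaField (List.ofFn σ) u (Fin.cons t (Y p.1 p.2))‖ₑ :=
    Finset.measurable_sum _ fun n _ => Finset.measurable_sum _ fun σ _ => meas _
  have measTotal : Measurable (Function.uncurry fun (h : Fin 3 → ℝ) (ρ : ℝ) =>
      ENNReal.ofReal (5 * K ^ 2) * (ENNReal.ofReal ρ * ∑ n ∈ Finset.range 3,
        ∑ σ : Fin n → Fin 10, ‖opIter GammaField (List.ofFn σ) u (Fin.cons t (Y h ρ))‖ₑ)) :=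
    ((ENNReal.measurable_ofReal.comp measurable_snd).mul measSum).const_mul
      (ENNReal.ofReal (5 * K ^ 2))
  set E := gammaEnergy 3 (fun _ : Unit => u) t with hE
  have hE0 : 0 ≤ E := Finset.sum_nonneg fun _ _ => Finset.sum_nonneg fun _ _ =>
    Finset.sum_nonneg fun _ _ => L2x_nonneg _ _
  have total : ENNReal.ofReal (1 / 64) * ‖u (Fin.cons t x)‖ₑ ≤
      ENNReal.ofReal (5 * K ^ 2 / √κ * E * 2) := by
    calc ENNReal.ofReal (1 / 64) * ‖u (Fin.cons t x)‖ₑ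
        = ∫⁻ _ in chartCube, ‖u (Fin.cons t x)‖ₑ := by
          rw [setLIntegral_const, volume_chartCube, mul_comm]
      _ ≤ ∫⁻ h in chartCube, ∫⁻ ρ in Set.Ioc (0 : ℝ) 1,
          ENNReal.ofReal (5 * K ^ 2) * (ENNReal.ofReal ρ * ∑ n ∈ Finset.range 3,
          ∑ σ : Fin n → Fin 10, ‖opIter GammaField (List.ofFn σ) u (Fin.cons t (Y h ρ))‖ₑ) :=
          setLIntegral_mono_ae' hQ (Filter.Eventually.of_forall curve)
      _ = ∫⁻ ρ in Set.Ioc (0 : ℝ) 1, ∫⁻ h in chartCube,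
          ENNReal.ofReal (5 * K ^ 2) * (ENNReal.ofReal ρ * ∑ n ∈ Finset.range 3,
          ∑ σ : Fin n → Fin 10, ‖opIter GammaField (List.ofFn σ) u (Fin.cons t (Y h ρ))‖ₑ) := by
          exact lintegral_lintegral_swap measTotal.aemeasurable
      _ ≤ ∫⁻ ρ in Set.Ioc (0 : ℝ) 1,
          ENNReal.ofReal (5 * K ^ 2 / √κ * E) * ENNReal.ofReal (ρ ^ (-(1 / 2) : ℝ)) := by
          refine setLIntegral_mono_ae' measurableSet_Ioc
            (Filter.Eventually.of_forall fun ρ hρ => ?_)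
          have hρ0 := hρ.1
          rw [lintegral_const_mul _ (Measurable.const_mul (Finset.measurable_sum _ fun n _ =>
              Finset.measurable_sum _ fun σ _ => measρ _ ρ) _),
            lintegral_const_mul _ (Finset.measurable_sum _ fun n _ =>
              Finset.measurable_sum _ fun σ _ => measρ _ ρ),
            lintegral_finsetSum _ fun n _ => Finset.measurable_sum _ fun σ _ => measρ _ ρ]
          have inner : ∑ n ∈ Finset.range 3, ∫⁻ h in chartCube, ∑ σ : Fin n → Fin 10,
              ‖opIter GammaField (List.ofFn σ) u (Fin.cons t (Y h ρ))‖ₑ ≤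
              ENNReal.ofReal (1 / √(κ * ρ ^ 3) * E) := by
            have hpos : 0 ≤ 1 / √(κ * ρ ^ 3) := by positivity
            rw [hE, gammaEnergy, Finset.mul_sum, ENNReal.ofReal_sum_of_nonneg fun n _ =>
              mul_nonneg hpos (Finset.sum_nonneg fun _ _ =>
                Finset.sum_nonneg fun _ _ => L2x_nonneg _ _)]
            refine Finset.sum_le_sum fun n _ => ?_
            rw [lintegral_finsetSum _ fun σ _ => measρ _ ρ, Finset.mul_sum,
              ENNReal.ofReal_sum_of_nonneg fun σ _ =>
              mul_nonneg hpos (Finset.sum_nonneg fun _ _ => L2x_nonneg _ _)]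
            refine Finset.sum_le_sum fun σ _ => ?_
            simpa using slice ρ hρ (List.ofFn σ)
          refine (mul_le_mul_right (mul_le_mul_right inner _) _).trans (le_of_eq ?_)
          rw [← ENNReal.ofReal_mul hρ0.le, ← ENNReal.ofReal_mul (by positivity),
            ← ENNReal.ofReal_mul (by positivity)]
          congr 1
          have e1 : √(κ * ρ ^ 3) = √κ * (ρ * √ρ) := by
            rw [Real.sqrt_mul hκ.le, show ρ ^ 3 = ρ ^ 2 * ρ by ring,
              Real.sqrt_mul (by positivity), Real.sqrt_sq hρ0.le]
          rw [e1, Real.rpow_neg hρ0.le, ← Real.sqrt_eq_rpow]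
          have : 0 < √ρ := Real.sqrt_pos.2 hρ0
          have : 0 < √κ := Real.sqrt_pos.2 hκ
          field_simp
      _ = ENNReal.ofReal (5 * K ^ 2 / √κ * E * 2) := by
          rw [lintegral_const_mul _ (by fun_prop), lintegral_ofReal_rpow_neg_half,
            ← ENNReal.ofReal_mul (by positivity)]
  rw [Real.enorm_eq_ofReal_abs, ← ENNReal.ofReal_mul (by norm_num),
    ENNReal.ofReal_le_ofReal_iff (by positivity)] at total
  calc |u (Fin.cons t x)| = 64 * (1 / 64 * |u (Fin.cons t x)|) := by ring
    _ ≤ 64 * (5 * K ^ 2 / √κ * E * 2) := by linarith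
    _ = 640 * K ^ 2 / √κ * E := by ring

theorem hasDerivAt_comp_finCons {u : (Fin 4 → ℝ) → ℝ} (hu : ContDiff ℝ (⊤ : ℕ∞) u) {t ρ : ℝ}
    {y : ℝ → Fin 3 → ℝ} {v : Fin 3 → ℝ} (hy : HasDerivAt y v ρ) :
    HasDerivAt (fun ρ => u (Fin.cons t (y ρ)))
      (v 0 * pd 1 u (Fin.cons t (y ρ)) + v 1 * pd 2 u (Fin.cons t (y ρ)) +
        v 2 * pd 3 u (Fin.cons t (y ρ))) ρ := by
  have hcons : HasDerivAt (fun ρ => (Fin.cons t (y ρ) : Fin 4 → ℝ)) (Fin.cons 0 v) ρ := by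
    rw [hasDerivAt_pi] at hy ⊢
    intro i
    refine Fin.cases ?_ (fun j => ?_) i
    · simpa using hasDerivAt_const ρ t
    · simpa using hy j
  refine ((hu.differentiable (by simp) _).hasFDerivAt.comp_hasDerivAt ρ hcons).congr_deriv ?_
  rw [fderiv_eq_sum_pd, Fin.sum_univ_four]
  simp only [Fin.cons_zero, zero_mul, zero_add]
  rfl

/-- The coefficients of the combination `p · ∂_x + q · (x × ∂_x)` of the fields `Γ`. -/
def spatialCoeff (p q : Fin 3 → ℝ) : Fin 10 → ℝ :=
  ![0, p 0, p 1, p 2, q 2, -q 1, q 0, 0, 0, 0]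

theorem sum_spatialCoeff (p q : Fin 3 → ℝ) (u : (Fin 4 → ℝ) → ℝ) (t : ℝ) (x : Fin 3 → ℝ) :
    ∑ a, spatialCoeff p q a * GammaField a u (Fin.cons t x) =
      (p 0 + q 1 * x 2 - q 2 * x 1) * pd 1 u (Fin.cons t x) +
      (p 1 + q 2 * x 0 - q 0 * x 2) * pd 2 u (Fin.cons t x) +
      (p 2 + q 0 * x 1 - q 1 * x 0) * pd 3 u (Fin.cons t x) := by
  have e1 : (Fin.cons t x : Fin 4 → ℝ) 1 = x 0 := rfl
  have e2 : (Fin.cons t x : Fin 4 → ℝ) 2 = x 1 := rfl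
  have e3 : (Fin.cons t x : Fin 4 → ℝ) 3 = x 2 := rfl
  simp [Fin.sum_univ_succ, spatialCoeff, GammaField, e1, e2, e3]
  ring

theorem hasDerivAt_spatialCoeff {p q p' q' : ℝ → Fin 3 → ℝ} {ρ : ℝ}
    (hp : ∀ i, HasDerivAt (fun ρ => p ρ i) (p' ρ i) ρ)
    (hq : ∀ i, HasDerivAt (fun ρ => q ρ i) (q' ρ i) ρ) (a : Fin 10) :
    HasDerivAt (fun ρ => spatialCoeff (p ρ) (q ρ) a) (spatialCoeff (p' ρ) (q' ρ) a) ρ := by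
  fin_cases a
  exacts [hasDerivAt_const ρ _, hp 0, hp 1, hp 2, hq 2, (hq 1).neg, hq 0, hasDerivAt_const ρ _,
    hasDerivAt_const ρ _, hasDerivAt_const ρ _]

theorem continuous_spatialCoeff {p q : ℝ → Fin 3 → ℝ} (hp : ∀ i, Continuous fun ρ => p ρ i)
    (hq : ∀ i, Continuous fun ρ => q ρ i) (a : Fin 10) :
    Continuous fun ρ => spatialCoeff (p ρ) (q ρ) a := by
  fin_cases a
  exacts [continuous_const, hp 0, hp 1, hp 2, hq 2, (hq 1).neg, hq 0, continuous_const,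
    continuous_const, continuous_const]

theorem abs_spatialCoeff_le {p q : Fin 3 → ℝ} {K : ℝ} (hp : ∀ i, |p i| ≤ K)
    (hq : ∀ i, |q i| ≤ K) (a : Fin 10) : |spatialCoeff p q a| ≤ K := by
  have h0 : |(0 : ℝ)| ≤ K := abs_zero.trans_le ((abs_nonneg _).trans (hp 0))
  fin_cases a
  exacts [h0, hp 0, hp 1, hp 2, hq 2, (abs_neg _).trans_le (hq 1), hq 0, h0, h0, h0]

/-- The Sobolev inequality in three dimensions, from the chart of straight rays. -/
theorem abs_le_gammaEnergy {u : (Fin 4 → ℝ) → ℝ} (hu : ContDiff ℝ (⊤ : ℕ∞) u)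
    (hs : HasCompactSupport u) (t : ℝ) (x : Fin 3 → ℝ) :
    |u (Fin.cons t x)| ≤ 640 * gammaEnergy 3 (fun _ : Unit => u) t := by
  have hcube : ∀ h ∈ chartCube, ∀ i, |h i| ≤ 1 := by
    intro h hh i
    have h0 : 0 ≤ h i := hh.1 i
    have h1 : h i ≤ 1 / 4 := hh.2 i
    rw [abs_of_nonneg h0]
    linarith
  have key := abs_le_gammaEnergy_of_chart (K := 1) (κ := 1) (t := t) le_rfl one_pos (x := x)
    (Y := fun h ρ => x + ρ • h) (c := fun h a _ => spatialCoeff h 0 a)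
    (c' := fun _ a _ => spatialCoeff 0 0 a)
    (D := fun _ ρ => ρ • ContinuousLinearMap.id ℝ _)
    (by simp) (by unfold Function.uncurry; fun_prop)
    (fun h u hu ρ => by
      have hy : HasDerivAt (fun ρ : ℝ => x + ρ • h) h ρ := by
        simpa using ((hasDerivAt_id ρ).smul_const h).const_add x
      refine (hasDerivAt_comp_finCons hu hy).congr_deriv ?_
      rw [sum_spatialCoeff]
      simp)
    (fun h a ρ => hasDerivAt_spatialCoeff (p := fun _ => h) (q := fun _ => 0) (p' := fun _ => 0)
      (q' := fun _ => 0) (fun i => hasDerivAt_const ρ _) (fun i => hasDerivAt_const ρ _) a)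
    (fun h a => continuous_const)
    (fun h hh a ρ _ => abs_spatialCoeff_le (hcube h hh) (by simp) a)
    (fun h hh a ρ _ => abs_spatialCoeff_le (by simp) (by simp) a)
    (fun h ρ => by
      simpa using ((hasFDerivAt_id (𝕜 := ℝ) h).const_smul ρ).const_add x)
    (fun ρ hρ h _ h' _ e => by simpa [hρ.1.ne'] using e)
    (fun ρ hρ h _ => by
      have hd : (ρ • ContinuousLinearMap.id ℝ (Fin 3 → ℝ)).det = ρ ^ 3 := by
        rw [ContinuousLinearMap.det]
        simp
      rw [hd, one_mul]
      exact le_abs_self _)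
    hu hs
  simpa using key

/-- The squared Euclidean length of a vector of `ℝ³`. -/
def lenSq (v : Fin 3 → ℝ) : ℝ := v 0 ^ 2 + v 1 ^ 2 + v 2 ^ 2

/-- The Euclidean inner product of `ℝ³`. -/
def dot (v w : Fin 3 → ℝ) : ℝ := v 0 * w 0 + v 1 * w 1 + v 2 * w 2

/-- The triple product `v · (w × z)`. -/
def triple (v w z : Fin 3 → ℝ) : ℝ :=
  v 0 * (w 1 * z 2 - w 2 * z 1) + v 1 * (w 2 * z 0 - w 0 * z 2) + v 2 * (w 0 * z 1 - w 1 * z 0)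

/-- The inverse Euclidean length. -/
def invLen (v : Fin 3 → ℝ) : ℝ := (√(lenSq v))⁻¹

/-- The tangential velocity with parameters `h` in the directions `A`, `B`. -/
def tilt (A B h : Fin 3 → ℝ) : Fin 3 → ℝ := fun i => h 0 * A i + h 1 * B i

/-- The line through `ω` with velocity `tilt A B h`. -/
def tiltedRay (A B ω h : Fin 3 → ℝ) (ρ : ℝ) : Fin 3 → ℝ := fun i => ω i + ρ * tilt A B h i

/-- The chart around `R ω` given by the radius `R + ρ h₂` and the direction of `tiltedRay`. -/
def sphericalChart (R : ℝ) (A B ω h : Fin 3 → ℝ) (ρ : ℝ) : Fin 3 → ℝ := fun i =>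
  (R + ρ * h 2) * (invLen (tiltedRay A B ω h ρ) * tiltedRay A B ω h ρ i)

theorem lenSq_nonneg (v : Fin 3 → ℝ) : 0 ≤ lenSq v := by unfold lenSq; positivity

theorem invLen_nonneg (v : Fin 3 → ℝ) : 0 ≤ invLen v := by unfold invLen; positivity

theorem invLen_sq_mul_lenSq {v : Fin 3 → ℝ} (hv : 0 < lenSq v) : invLen v ^ 2 * lenSq v = 1 := by
  rw [invLen, inv_pow, Real.sq_sqrt hv.le, inv_mul_cancel₀ hv.ne']

theorem invLen_pos {v : Fin 3 → ℝ} (hv : 0 < lenSq v) : 0 < invLen v := by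
  unfold invLen; positivity

theorem triple_tiltedRay (A B ω h : Fin 3 → ℝ) (ρ : ℝ) :
    triple A B (tiltedRay A B ω h ρ) = triple A B ω := by
  simp only [triple, tiltedRay, tilt]; ring

theorem lenSq_pos_of_triple_ne_zero {A B v : Fin 3 → ℝ} (hd : triple A B v ≠ 0) :
    0 < lenSq v := by
  refine (lenSq_nonneg v).lt_of_ne fun h0 => hd ?_
  unfold lenSq at h0
  have h₀ : v 0 = 0 := by nlinarith [sq_nonneg (v 0), sq_nonneg (v 1), sq_nonneg (v 2)]
  have h₁ : v 1 = 0 := by nlinarith [sq_nonneg (v 0), sq_nonneg (v 1), sq_nonneg (v 2)]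
  have h₂ : v 2 = 0 := by nlinarith [sq_nonneg (v 0), sq_nonneg (v 1), sq_nonneg (v 2)]
  simp [triple, h₀, h₁, h₂]

theorem lenSq_tiltedRay_pos {A B ω : Fin 3 → ℝ} (hd : triple A B ω ≠ 0) (h : Fin 3 → ℝ)
    (ρ : ℝ) : 0 < lenSq (tiltedRay A B ω h ρ) :=
  lenSq_pos_of_triple_ne_zero (A := A) (B := B) (by rwa [triple_tiltedRay])

theorem hasDerivAt_inv_sqrt {s : ℝ} (hs : 0 < s) :
    HasDerivAt (fun s => (√s)⁻¹) (-(√s)⁻¹ ^ 3 / 2) s := by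
  have h0 : 0 < √s := Real.sqrt_pos.2 hs
  refine ((Real.hasDerivAt_sqrt hs.ne').inv h0.ne').congr_deriv ?_
  field_simp

theorem hasFDerivAt_lenSq (v : Fin 3 → ℝ) :
    HasFDerivAt lenSq (∑ i, (2 * v i) • ContinuousLinearMap.proj (R := ℝ) (φ := fun _ => ℝ) i)
      v := by
  have hp := fun i : Fin 3 => (hasFDerivAt_apply (𝕜 := ℝ) (F' := fun _ => ℝ) i v).pow 2
  refine (((hp 0).add (hp 1)).add (hp 2)).congr_fderiv ?_
  ext k
  simp [Fin.sum_univ_three]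

theorem hasFDerivAt_invLen {v : Fin 3 → ℝ} (hv : 0 < lenSq v) :
    HasFDerivAt invLen (∑ i, (-invLen v ^ 3 * v i) •
      ContinuousLinearMap.proj (R := ℝ) (φ := fun _ => ℝ) i) v := by
  refine ((hasDerivAt_inv_sqrt hv).comp_hasFDerivAt v (hasFDerivAt_lenSq v)).congr_fderiv ?_
  ext k
  simp only [invLen, smul_apply, Fin.sum_univ_three, smul_eq_mul,
    ContinuousLinearMap.proj_apply, add_apply]
  ring

theorem hasDerivAt_tiltedRay (A B ω h : Fin 3 → ℝ) (ρ : ℝ) :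
    HasDerivAt (tiltedRay A B ω h) (tilt A B h) ρ := by
  rw [hasDerivAt_pi]
  intro i
  simpa [tiltedRay] using ((hasDerivAt_id ρ).mul_const (tilt A B h i)).const_add (ω i)

theorem hasDerivAt_invLen_tiltedRay {A B ω : Fin 3 → ℝ} (hd : triple A B ω ≠ 0)
    (h : Fin 3 → ℝ) (ρ : ℝ) :
    HasDerivAt (fun ρ => invLen (tiltedRay A B ω h ρ))
      (-invLen (tiltedRay A B ω h ρ) ^ 3 * dot (tiltedRay A B ω h ρ) (tilt A B h)) ρ := by
  refine ((hasFDerivAt_invLen (lenSq_tiltedRay_pos hd h ρ)).comp_hasDerivAt ρ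
    (hasDerivAt_tiltedRay A B ω h ρ)).congr_deriv ?_
  simp only [smul_apply, Fin.sum_univ_three, smul_eq_mul, dot,
    ContinuousLinearMap.proj_apply, add_apply]
  ring

theorem hasDerivAt_sphericalChart {A B ω : Fin 3 → ℝ} (hd : triple A B ω ≠ 0) (R : ℝ)
    (h : Fin 3 → ℝ) (ρ : ℝ) :
    HasDerivAt (sphericalChart R A B ω h) (fun i =>
      h 2 * (invLen (tiltedRay A B ω h ρ) * tiltedRay A B ω h ρ i) +
      (R + ρ * h 2) * (-invLen (tiltedRay A B ω h ρ) ^ 3 *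
        dot (tiltedRay A B ω h ρ) (tilt A B h) * tiltedRay A B ω h ρ i +
        invLen (tiltedRay A B ω h ρ) * tilt A B h i)) ρ := by
  rw [hasDerivAt_pi]
  intro i
  have h1 : HasDerivAt (fun ρ => R + ρ * h 2) (h 2) ρ := by
    simpa using ((hasDerivAt_id ρ).mul_const (h 2)).const_add R
  exact h1.mul ((hasDerivAt_invLen_tiltedRay hd h ρ).mul
    (hasDerivAt_pi.1 (hasDerivAt_tiltedRay A B ω h ρ) i))

/-- The Jacobian matrix of `sphericalChart` in the parameter `h`. -/
def sphericalJacobian (R : ℝ) (A B ω h : Fin 3 → ℝ) (ρ : ℝ) : Matrix (Fin 3) (Fin 3) ℝ :=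
  Matrix.of fun i => ![
    (R + ρ * h 2) * ρ * (invLen (tiltedRay A B ω h ρ) * A i -
      invLen (tiltedRay A B ω h ρ) ^ 3 * dot (tiltedRay A B ω h ρ) A * tiltedRay A B ω h ρ i),
    (R + ρ * h 2) * ρ * (invLen (tiltedRay A B ω h ρ) * B i -
      invLen (tiltedRay A B ω h ρ) ^ 3 * dot (tiltedRay A B ω h ρ) B * tiltedRay A B ω h ρ i),
    ρ * (invLen (tiltedRay A B ω h ρ) * tiltedRay A B ω h ρ i)]

theorem hasFDerivAt_sphericalChart {A B ω : Fin 3 → ℝ} (hd : triple A B ω ≠ 0) (R : ℝ)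
    (h : Fin 3 → ℝ) (ρ : ℝ) :
    HasFDerivAt (fun h => sphericalChart R A B ω h ρ)
      (sphericalJacobian R A B ω h ρ).mulVecLin.toContinuousLinearMap h := by
  have hp := fun i : Fin 3 => hasFDerivAt_apply (𝕜 := ℝ) (F' := fun _ => ℝ) i h
  have hray : HasFDerivAt (fun h => tiltedRay A B ω h ρ) (ContinuousLinearMap.pi fun i =>
      ρ • (A i • ContinuousLinearMap.proj (R := ℝ) (φ := fun _ : Fin 3 => ℝ) 0 +
        B i • ContinuousLinearMap.proj (R := ℝ) (φ := fun _ : Fin 3 => ℝ) 1)) h := by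
    rw [hasFDerivAt_pi]
    intro i
    exact ((((hp 0).mul_const (A i)).add ((hp 1).mul_const (B i))).const_mul ρ).const_add (ω i)
  have hN := (hasFDerivAt_invLen (lenSq_tiltedRay_pos hd h ρ)).comp h hray
  rw [hasFDerivAt_pi']
  intro i
  have hs := ((hp 2).const_mul ρ).const_add R
  refine (hs.mul (hN.mul (hasFDerivAt_pi.1 hray i))).congr_fderiv ?_
  ext k
  simp only [Pi.mul_apply, add_apply, smul_apply, ContinuousLinearMap.coe_comp, Function.comp_apply,
    ContinuousLinearMap.proj_apply, ContinuousLinearMap.pi_apply, smul_eq_mul,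
    LinearMap.coe_toContinuousLinearMap', Matrix.mulVecLin_apply, Matrix.mulVec, dotProduct,
    Fin.sum_univ_three, sphericalJacobian, Matrix.of_apply, Matrix.cons_val, dot]
  ring

theorem det_sphericalJacobian (R : ℝ) (A B ω h : Fin 3 → ℝ) (ρ : ℝ) :
    (sphericalJacobian R A B ω h ρ).mulVecLin.toContinuousLinearMap.det =
      (R + ρ * h 2) ^ 2 * ρ ^ 3 * invLen (tiltedRay A B ω h ρ) ^ 3 * triple A B ω := by
  rw [← triple_tiltedRay A B ω h ρ, ContinuousLinearMap.det, LinearMap.coe_toContinuousLinearMap,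
    ← Matrix.toLin'_apply', LinearMap.det_toLin', Matrix.det_fin_three]
  simp only [sphericalJacobian, Matrix.of_apply, Matrix.cons_val, triple]
  ring

theorem injOn_sphericalChart {A B ω : Fin 3 → ℝ} (hd : triple A B ω ≠ 0) {R ρ : ℝ} (hR : 0 < R)
    (hρ : 0 < ρ) : Set.InjOn (fun h => sphericalChart R A B ω h ρ) chartCube := by
  intro h hh h' hh' e
  have e : ∀ i, (R + ρ * h 2) * (invLen (tiltedRay A B ω h ρ) * tiltedRay A B ω h ρ i) =
      (R + ρ * h' 2) * (invLen (tiltedRay A B ω h' ρ) * tiltedRay A B ω h' ρ i) :=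
    fun i => congrFun e i
  have t₁ := triple_tiltedRay A B ω h ρ
  have t₂ := triple_tiltedRay A B ω h' ρ
  have n₁ := invLen_sq_mul_lenSq (lenSq_tiltedRay_pos hd h ρ)
  have n₂ := invLen_sq_mul_lenSq (lenSq_tiltedRay_pos hd h' ρ)
  have N₁ := invLen_pos (lenSq_tiltedRay_pos hd h ρ)
  have hs₁ : 0 < R + ρ * h 2 := by
    have : 0 ≤ h 2 := hh.1 2
    positivity
  have hs₂ : 0 < R + ρ * h' 2 := by
    have : 0 ≤ h' 2 := hh'.1 2
    positivity
  have hU : ∀ i, tiltedRay A B ω h ρ i - tiltedRay A B ω h' ρ i =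
      ρ * ((h 0 - h' 0) * A i + (h 1 - h' 1) * B i) := by
    intro i; simp only [tiltedRay, tilt]; ring
  generalize tiltedRay A B ω h ρ = U at *
  generalize tiltedRay A B ω h' ρ = U' at *
  generalize invLen U = N at *
  generalize invLen U' = N' at *
  generalize hs : R + ρ * h 2 = s at *
  generalize hs' : R + ρ * h' 2 = s' at *
  have hsq : s ^ 2 = s' ^ 2 := by
    calc s ^ 2 = (s * (N * U 0)) ^ 2 + (s * (N * U 1)) ^ 2 + (s * (N * U 2)) ^ 2 := by
          rw [lenSq] at n₁; linear_combination (-s ^ 2) * n₁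
      _ = (s' * (N' * U' 0)) ^ 2 + (s' * (N' * U' 1)) ^ 2 + (s' * (N' * U' 2)) ^ 2 := by
          rw [e 0, e 1, e 2]
      _ = s' ^ 2 := by rw [lenSq] at n₂; linear_combination s' ^ 2 * n₂
  have hss : s = s' := by
    rcases sq_eq_sq_iff_eq_or_eq_neg.1 hsq with h | h
    · exact h
    · linarith
  have h2 : h 2 = h' 2 := by
    have : ρ * h 2 = ρ * h' 2 := by linarith
    exact mul_left_cancel₀ hρ.ne' this
  have eN : ∀ i, N * U i = N' * U' i := fun i => by
    have := e i
    rw [← hss] at this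
    exact mul_left_cancel₀ hs₁.ne' this
  have hNN : N = N' := by
    have : N * triple A B U = N' * triple A B U' := by
      simp only [triple]
      linear_combination (A 1 * B 2 - A 2 * B 1) * eN 0 + (A 2 * B 0 - A 0 * B 2) * eN 1 +
        (A 0 * B 1 - A 1 * B 0) * eN 2
    rw [t₁, t₂] at this
    exact mul_right_cancel₀ hd this
  have hz : ∀ i, (h 0 - h' 0) * A i + (h 1 - h' 1) * B i = 0 := fun i => by
    have h1 : U i = U' i := by
      have := eN i
      rw [← hNN] at this
      exact mul_left_cancel₀ N₁.ne' this
    have h2 := hU i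
    rw [h1, sub_self] at h2
    exact (mul_eq_zero.1 h2.symm).resolve_left hρ.ne'
  have h0 : h 0 = h' 0 := by
    have : (h 0 - h' 0) * triple A B ω = 0 := by
      simp only [triple]
      linear_combination (B 1 * ω 2 - B 2 * ω 1) * hz 0 + (B 2 * ω 0 - B 0 * ω 2) * hz 1 +
        (B 0 * ω 1 - B 1 * ω 0) * hz 2
    exact sub_eq_zero.1 ((mul_eq_zero.1 this).resolve_right hd)
  have h1 : h 1 = h' 1 := by
    have : (h 1 - h' 1) * triple A B ω = 0 := by
      simp only [triple]
      linear_combination (-(A 1 * ω 2 - A 2 * ω 1)) * hz 0 + (-(A 2 * ω 0 - A 0 * ω 2)) * hz 1 +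
        (-(A 0 * ω 1 - A 1 * ω 0)) * hz 2
    exact sub_eq_zero.1 ((mul_eq_zero.1 this).resolve_right hd)
  ext i
  fin_cases i
  exacts [h0, h1, h2]

theorem abs_le_one_of_lenSq_eq_one {v : Fin 3 → ℝ} (hv : lenSq v = 1) (i : Fin 3) :
    |v i| ≤ 1 := by
  unfold lenSq at hv
  have h0 := sq_nonneg (v 0)
  have h1 := sq_nonneg (v 1)
  have h2 := sq_nonneg (v 2)
  rw [← sq_le_one_iff_abs_le_one]
  fin_cases i
  exacts [show v 0 ^ 2 ≤ 1 by linarith, show v 1 ^ 2 ≤ 1 by linarith,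
    show v 2 ^ 2 ≤ 1 by linarith]

theorem dot_sq_le (v w : Fin 3 → ℝ) : dot v w ^ 2 ≤ lenSq v * lenSq w := by
  unfold dot lenSq
  nlinarith [sq_nonneg (v 0 * w 1 - v 1 * w 0), sq_nonneg (v 0 * w 2 - v 2 * w 0),
    sq_nonneg (v 1 * w 2 - v 2 * w 1)]

section Bounds

variable {A B ω h : Fin 3 → ℝ}

theorem abs_tilt_le (hA : lenSq A = 1) (hB : lenSq B = 1) (hh : h ∈ chartCube) (i : Fin 3) :
    |tilt A B h i| ≤ 1 / 2 := by
  have a := abs_le_one_of_lenSq_eq_one hA i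
  have b := abs_le_one_of_lenSq_eq_one hB i
  have h0 : 0 ≤ h 0 := hh.1 0
  have h1 : 0 ≤ h 1 := hh.1 1
  have h0' : h 0 ≤ 1 / 4 := hh.2 0
  have h1' : h 1 ≤ 1 / 4 := hh.2 1
  calc |tilt A B h i| ≤ |h 0 * A i| + |h 1 * B i| := abs_add_le _ _
    _ = h 0 * |A i| + h 1 * |B i| := by rw [abs_mul, abs_mul, abs_of_nonneg h0, abs_of_nonneg h1]
    _ ≤ 1 / 4 * 1 + 1 / 4 * 1 := by gcongr
    _ = 1 / 2 := by norm_num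

theorem abs_tiltedRay_le (hA : lenSq A = 1) (hB : lenSq B = 1) (hω : lenSq ω = 1)
    (hh : h ∈ chartCube) {ρ : ℝ} (hρ : ρ ∈ Set.Icc (0 : ℝ) 1) (i : Fin 3) :
    |tiltedRay A B ω h ρ i| ≤ 3 / 2 := by
  calc |tiltedRay A B ω h ρ i| ≤ |ω i| + |ρ * tilt A B h i| := abs_add_le _ _
    _ = |ω i| + ρ * |tilt A B h i| := by rw [abs_mul, abs_of_nonneg hρ.1]
    _ ≤ 1 + 1 * (1 / 2) := by
        gcongr
        exacts [abs_le_one_of_lenSq_eq_one hω i, hρ.2, abs_tilt_le hA hB hh i]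
    _ = 3 / 2 := by norm_num

theorem lenSq_tiltedRay_mem (hA : lenSq A = 1) (hB : lenSq B = 1) (hω : lenSq ω = 1)
    (hAB : dot A B = 0) (hh : h ∈ chartCube) {ρ : ℝ} (hρ : ρ ∈ Set.Icc (0 : ℝ) 1) :
    lenSq (tiltedRay A B ω h ρ) ∈ Set.Icc (1 / 4 : ℝ) 2 := by
  have h0 : 0 ≤ h 0 := hh.1 0
  have h1 : 0 ≤ h 1 := hh.1 1
  have h0' : h 0 ≤ 1 / 4 := hh.2 0
  have h1' : h 1 ≤ 1 / 4 := hh.2 1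
  have el : lenSq (tilt A B h) = h 0 ^ 2 + h 1 ^ 2 := by
    simp only [lenSq, dot, tilt] at *
    linear_combination h 0 ^ 2 * hA + h 1 ^ 2 * hB + 2 * h 0 * h 1 * hAB
  have hl : lenSq (tilt A B h) ≤ 1 / 8 := by rw [el]; nlinarith
  have hc := dot_sq_le ω (tilt A B h)
  rw [hω, one_mul] at hc
  obtain ⟨l, r⟩ := abs_le_of_sq_le_sq' (a := dot ω (tilt A B h)) (b := 3 / 8) (by linarith)
    (by norm_num)
  have e : lenSq (tiltedRay A B ω h ρ) =
      1 + 2 * (ρ * dot ω (tilt A B h)) + ρ ^ 2 * lenSq (tilt A B h) := by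
    simp only [lenSq, dot, tiltedRay] at *
    linear_combination hω
  have hρ2 : ρ ^ 2 ≤ 1 := pow_le_one₀ hρ.1 hρ.2
  have h3 : ρ ^ 2 * lenSq (tilt A B h) ≤ 1 * (1 / 8) :=
    mul_le_mul hρ2 hl (lenSq_nonneg _) zero_le_one
  have h4 : 0 ≤ ρ ^ 2 * lenSq (tilt A B h) := mul_nonneg (sq_nonneg _) (lenSq_nonneg _)
  have h5 : ρ * dot ω (tilt A B h) ≤ 3 / 8 := by nlinarith [hρ.1, hρ.2]
  have h6 : -(3 / 8) ≤ ρ * dot ω (tilt A B h) := by nlinarith [hρ.1, hρ.2]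
  rw [e]
  constructor <;> linarith

theorem invLen_mem {v : Fin 3 → ℝ} (hv : lenSq v ∈ Set.Icc (1 / 4 : ℝ) 2) :
    invLen v ≤ 2 ∧ 1 / 4 ≤ invLen v ^ 3 := by
  have hpos : 0 < lenSq v := by linarith [hv.1]
  have e := invLen_sq_mul_lenSq hpos
  have h0 := invLen_pos hpos
  have h1 : invLen v ≤ 2 := by
    by_contra! hc
    nlinarith [hv.1, mul_pos h0 h0]
  have h2 : 1 / 2 ≤ invLen v ^ 2 := by nlinarith [hv.2, sq_nonneg (invLen v)]
  have h3 : 1 / 2 ≤ invLen v := by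
    by_contra! hc
    nlinarith
  exact ⟨h1, by nlinarith⟩

end Bounds

theorem abs_mul_le {a b M N : ℝ} (ha : |a| ≤ M) (hb : |b| ≤ N) : |a * b| ≤ M * N := by
  rw [abs_mul]
  exact mul_le_mul ha hb (abs_nonneg _) ((abs_nonneg _).trans ha)

/-- The cross product `v × w`. -/
def cross (v w : Fin 3 → ℝ) : Fin 3 → ℝ :=
  ![v 1 * w 2 - v 2 * w 1, v 2 * w 0 - v 0 * w 2, v 0 * w 1 - v 1 * w 0]

/-- A pointwise bound with decay in the radius, from the chart `sphericalChart`. -/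
theorem mul_abs_le_gammaEnergy_of_frame {A B ω : Fin 3 → ℝ} (hA : lenSq A = 1) (hB : lenSq B = 1)
    (hω : lenSq ω = 1) (hAB : dot A B = 0) (hd : 1 / 2 ≤ |triple A B ω|) {R : ℝ} (hR : 0 < R)
    {u : (Fin 4 → ℝ) → ℝ} (hu : ContDiff ℝ (⊤ : ℕ∞) u) (hs : HasCompactSupport u) (t : ℝ) :
    R * |u (Fin.cons t fun i => R * ω i)| ≤
      640 * 72 ^ 2 * √8 * gammaEnergy 3 (fun _ : Unit => u) t := by
  have hd0 : triple A B ω ≠ 0 := by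
    rw [← abs_pos]; linarith
  have hUc : Continuous fun p : (Fin 3 → ℝ) × ℝ => tiltedRay A B ω p.1 p.2 := by
    unfold tiltedRay tilt; fun_prop
  have hNc : Continuous fun p : (Fin 3 → ℝ) × ℝ => invLen (tiltedRay A B ω p.1 p.2) :=
    continuous_iff_continuousAt.2 fun p => ContinuousAt.comp (g := invLen)
      (hasFDerivAt_invLen (lenSq_tiltedRay_pos hd0 p.1 p.2)).continuousAt hUc.continuousAt
  have hUρ : ∀ h i, Continuous fun ρ => tiltedRay A B ω h ρ i := fun h i =>
    (continuous_apply i).comp (hUc.comp (Continuous.prodMk_right h))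
  have hNρ : ∀ h, Continuous fun ρ => invLen (tiltedRay A B ω h ρ) := fun h =>
    hNc.comp (Continuous.prodMk_right h)
  have hdotc : ∀ h, Continuous fun ρ => dot (tiltedRay A B ω h ρ) (tilt A B h) := fun h => by
    have h0 := hUρ h 0
    have h1 := hUρ h 1
    have h2 := hUρ h 2
    unfold dot
    fun_prop
  have hN2 : ∀ h ∈ chartCube, ∀ ρ ∈ Set.Icc (0 : ℝ) 1, |invLen (tiltedRay A B ω h ρ)| ≤ 2 :=
    fun h hh ρ hρ => by
      rw [abs_of_nonneg (invLen_nonneg _)]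
      exact (invLen_mem (lenSq_tiltedRay_mem hA hB hω hAB hh hρ)).1
  have hN3 : ∀ h ∈ chartCube, ∀ ρ ∈ Set.Icc (0 : ℝ) 1,
      |-invLen (tiltedRay A B ω h ρ) ^ 3 * dot (tiltedRay A B ω h ρ) (tilt A B h)| ≤ 18 := by
    intro h hh ρ hρ
    have hb := fun i => abs_mul_le (abs_tiltedRay_le hA hB hω hh hρ i) (abs_tilt_le hA hB hh i)
    have hdot : |dot (tiltedRay A B ω h ρ) (tilt A B h)| ≤ 9 / 4 := by
      refine (abs_add_three _ _ _).trans ?_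
      linarith [hb 0, hb 1, hb 2]
    have h3 : |-invLen (tiltedRay A B ω h ρ) ^ 3| ≤ 8 := by
      rw [abs_neg, abs_pow]
      calc _ ≤ (2 : ℝ) ^ 3 := pow_le_pow_left₀ (abs_nonneg _) (hN2 h hh ρ hρ) 3
        _ = 8 := by norm_num
    exact (abs_mul_le h3 hdot).trans (by norm_num)
  have hh2 : ∀ h ∈ chartCube, |h 2| ≤ 1 / 4 := fun h hh => by
    rw [abs_of_nonneg (show 0 ≤ h 2 from hh.1 2)]
    exact hh.2 2
  have hcr : ∀ h ∈ chartCube, ∀ i, |cross ω (tilt A B h) i| ≤ 1 := by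
    intro h hh i
    have hb := fun i j => abs_mul_le (abs_le_one_of_lenSq_eq_one hω i) (abs_tilt_le hA hB hh j)
    have hsub : ∀ i j k l, |ω i * tilt A B h j - ω k * tilt A B h l| ≤ 1 := fun i j k l =>
      (abs_sub _ _).trans (by linarith [hb i j, hb k l])
    fin_cases i
    exacts [hsub 1 2 2 1, hsub 2 0 0 2, hsub 0 1 1 0]
  have key := abs_le_gammaEnergy_of_chart (K := 72) (κ := R ^ 2 / 8) (t := t) (by norm_num)
    (by positivity) (x := fun i => R * ω i) (Y := sphericalChart R A B ω)
    (c := fun h a ρ => spatialCoeff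
      (fun i => h 2 * (invLen (tiltedRay A B ω h ρ) * tiltedRay A B ω h ρ i))
      (fun i => invLen (tiltedRay A B ω h ρ) ^ 2 * cross ω (tilt A B h) i) a)
    (c' := fun h a ρ => spatialCoeff
      (fun i => h 2 * (-invLen (tiltedRay A B ω h ρ) ^ 3 *
        dot (tiltedRay A B ω h ρ) (tilt A B h) * tiltedRay A B ω h ρ i +
        invLen (tiltedRay A B ω h ρ) * tilt A B h i))
      (fun i => 2 * invLen (tiltedRay A B ω h ρ) * (-invLen (tiltedRay A B ω h ρ) ^ 3 *
        dot (tiltedRay A B ω h ρ) (tilt A B h)) * cross ω (tilt A B h) i) a)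
    (D := fun h ρ => (sphericalJacobian R A B ω h ρ).mulVecLin.toContinuousLinearMap)
    (fun h => by
      have h0 : tiltedRay A B ω h 0 = ω := by ext i; simp [tiltedRay]
      ext i
      simp [sphericalChart, h0, invLen, hω])
    (continuous_pi fun i => by
      have := (continuous_apply i).comp hUc
      simp only [Function.comp_def] at this
      unfold Function.uncurry sphericalChart
      fun_prop)
    (fun h u hu ρ => by
      refine (hasDerivAt_comp_finCons hu (hasDerivAt_sphericalChart hd0 R h ρ)).congr_deriv ?_
      rw [sum_spatialCoeff]
      have n := invLen_sq_mul_lenSq (lenSq_tiltedRay_pos hd0 h ρ)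
      have hcross : ∀ i, cross ω (tilt A B h) i = cross (tiltedRay A B ω h ρ) (tilt A B h) i := by
        intro i
        fin_cases i <;> simp [cross, tiltedRay] <;> ring
      simp only [hcross]
      clear hcross
      have hY : ∀ i, sphericalChart R A B ω h ρ i =
        (R + ρ * h 2) * (invLen (tiltedRay A B ω h ρ) * tiltedRay A B ω h ρ i) := fun _ => rfl
      generalize sphericalChart R A B ω h ρ = Y at *
      simp only [hY, dot, cross, Matrix.cons_val]
      clear hY
      simp only [lenSq] at n
      generalize tiltedRay A B ω h ρ = U at *
      generalize tilt A B h = V at *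
      generalize invLen U = N at *
      linear_combination (-(R + ρ * h 2) * N) * n * (V 0 * pd 1 u (Fin.cons t Y) +
        V 1 * pd 2 u (Fin.cons t Y) + V 2 * pd 3 u (Fin.cons t Y)))
    (fun h a ρ => hasDerivAt_spatialCoeff
      (p := fun ρ i => h 2 * (invLen (tiltedRay A B ω h ρ) * tiltedRay A B ω h ρ i))
      (q := fun ρ i => invLen (tiltedRay A B ω h ρ) ^ 2 * cross ω (tilt A B h) i)
      (p' := fun ρ i => h 2 * (-invLen (tiltedRay A B ω h ρ) ^ 3 *
        dot (tiltedRay A B ω h ρ) (tilt A B h) * tiltedRay A B ω h ρ i +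
        invLen (tiltedRay A B ω h ρ) * tilt A B h i))
      (q' := fun ρ i => 2 * invLen (tiltedRay A B ω h ρ) * (-invLen (tiltedRay A B ω h ρ) ^ 3 *
        dot (tiltedRay A B ω h ρ) (tilt A B h)) * cross ω (tilt A B h) i)
      (fun i => ((hasDerivAt_invLen_tiltedRay hd0 h ρ).mul
        (hasDerivAt_pi.1 (hasDerivAt_tiltedRay A B ω h ρ) i)).const_mul (h 2))
      (fun i => by
        simpa using ((hasDerivAt_invLen_tiltedRay hd0 h ρ).pow 2).mul_const
          (cross ω (tilt A B h) i)) a)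
    (fun h a => by
      have h1 := hUρ h
      have h2 := hNρ h
      have h3 := hdotc h
      exact continuous_spatialCoeff (fun i => by fun_prop) (fun i => by fun_prop) a)
    (fun h hh a ρ hρ => by
      refine abs_spatialCoeff_le (fun i => ?_) (fun i => ?_) a
      · exact (abs_mul_le (hh2 h hh) (abs_mul_le (hN2 h hh ρ hρ)
          (abs_tiltedRay_le hA hB hω hh hρ i))).trans (by norm_num)
      · rw [pow_two]
        exact (abs_mul_le (abs_mul_le (hN2 h hh ρ hρ) (hN2 h hh ρ hρ)) (hcr h hh i)).trans
          (by norm_num))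
    (fun h hh a ρ hρ => by
      refine abs_spatialCoeff_le (fun i => ?_) (fun i => ?_) a
      · refine (abs_mul_le (hh2 h hh) ((abs_add_le _ _).trans (add_le_add
          (abs_mul_le (hN3 h hh ρ hρ) (abs_tiltedRay_le hA hB hω hh hρ i))
          (abs_mul_le (hN2 h hh ρ hρ) (abs_tilt_le hA hB hh i))))).trans (by norm_num)
      · exact (abs_mul_le (abs_mul_le (abs_mul_le (abs_of_pos two_pos).le (hN2 h hh ρ hρ))
          (hN3 h hh ρ hρ)) (hcr h hh i)).trans (by norm_num))
    (fun h ρ => hasFDerivAt_sphericalChart hd0 R h ρ)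
    (fun ρ hρ => injOn_sphericalChart hd0 hR hρ.1)
    (fun ρ hρ h hh => by
      have hρ0 := hρ.1
      have h2 : 0 ≤ h 2 := hh.1 2
      rw [det_sphericalJacobian, abs_mul, abs_of_nonneg (by
        have := invLen_nonneg (tiltedRay A B ω h ρ)
        positivity)]
      have hN := (invLen_mem (lenSq_tiltedRay_mem hA hB hω hAB hh
        (Set.Ioc_subset_Icc_self hρ))).2
      have hRs : R ^ 2 ≤ (R + ρ * h 2) ^ 2 := by
        have : 0 ≤ ρ * h 2 := by positivity
        gcongr
        linarith
      calc R ^ 2 / 8 * ρ ^ 3 = R ^ 2 * ρ ^ 3 * (1 / 4) * (1 / 2) := by ring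
        _ ≤ _ := by gcongr)
    hu hs
  have hsq : √(R ^ 2 / 8) = R / √8 := by
    rw [Real.sqrt_div (sq_nonneg R), Real.sqrt_sq hR.le]
  rw [hsq] at key
  refine (mul_le_mul_of_nonneg_left key hR.le).trans (le_of_eq ?_)
  field_simp

theorem gammaEnergy_nonneg {ι : Type*} [Fintype ι] (N : ℕ) (f : ι → (Fin 4 → ℝ) → ℝ) (t : ℝ) :
    0 ≤ gammaEnergy N f t :=
  Finset.sum_nonneg fun _ _ => Finset.sum_nonneg fun _ _ => Finset.sum_nonneg fun _ _ =>
    L2x_nonneg _ _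

/-- A pointwise bound with decay in the radius, at a point `R ω` with `|ω| = 1`. -/
theorem mul_abs_le_gammaEnergy {ω : Fin 3 → ℝ} (hω : lenSq ω = 1) {R : ℝ} (hR : 0 < R)
    {u : (Fin 4 → ℝ) → ℝ} (hu : ContDiff ℝ (⊤ : ℕ∞) u) (hs : HasCompactSupport u) (t : ℝ) :
    R * |u (Fin.cons t fun i => R * ω i)| ≤
      640 * 72 ^ 2 * √8 * gammaEnergy 3 (fun _ : Unit => u) t := by
  have half : ∀ a : ℝ, (1 / 2) ^ 2 ≤ a ^ 2 → 1 / 2 ≤ |a| := fun a ha => by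
    simpa using sq_le_sq.1 ha
  have hω' : ω 0 ^ 2 + ω 1 ^ 2 + ω 2 ^ 2 = 1 := hω
  rcases le_or_gt ((1 / 2) ^ 2) (ω 0 ^ 2) with h0 | h0
  · exact mul_abs_le_gammaEnergy_of_frame (A := ![0, 1, 0]) (B := ![0, 0, 1])
      (by simp [lenSq]) (by simp [lenSq]) hω (by simp [dot])
      (by simpa [triple] using half _ h0) hR hu hs t
  rcases le_or_gt ((1 / 2) ^ 2) (ω 1 ^ 2) with h1 | h1
  · exact mul_abs_le_gammaEnergy_of_frame (A := ![1, 0, 0]) (B := ![0, 0, 1])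
      (by simp [lenSq]) (by simp [lenSq]) hω (by simp [dot])
      (by simpa [triple] using half _ h1) hR hu hs t
  · exact mul_abs_le_gammaEnergy_of_frame (A := ![1, 0, 0]) (B := ![0, 1, 0])
      (by simp [lenSq]) (by simp [lenSq]) hω (by simp [dot])
      (by simpa [triple] using half _ (by linarith)) hR hu hs t

/-- The weighted Sobolev inequality `⟨r⟩ |u(t,x)| ≲ ∑_{|β| ≤ 2} ‖Γ^β u(t,·)‖`. -/
theorem sqrt_mul_abs_le_gammaEnergy {u : (Fin 4 → ℝ) → ℝ} (hu : ContDiff ℝ (⊤ : ℕ∞) u)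
    (hs : HasCompactSupport u) (t : ℝ) (x : Fin 3 → ℝ) :
    √(1 + (x 0 ^ 2 + x 1 ^ 2 + x 2 ^ 2)) * |u (Fin.cons t x)| ≤
      (640 + 640 * 72 ^ 2 * √8) * gammaEnergy 3 (fun _ : Unit => u) t := by
  have hE : 0 ≤ gammaEnergy 3 (fun _ : Unit => u) t := gammaEnergy_nonneg _ _ _
  have hsplit : √(1 + lenSq x) ≤ 1 + √(lenSq x) := by
    refine Real.sqrt_le_iff.2 ⟨by positivity, ?_⟩
    nlinarith [Real.sq_sqrt (lenSq_nonneg x), Real.sqrt_nonneg (lenSq x)]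
  have hfar : √(lenSq x) * |u (Fin.cons t x)| ≤
      640 * 72 ^ 2 * √8 * gammaEnergy 3 (fun _ : Unit => u) t := by
    rcases (lenSq_nonneg x).eq_or_lt with h0 | h0
    · rw [← h0, Real.sqrt_zero, zero_mul]
      positivity
    have hR : 0 < √(lenSq x) := Real.sqrt_pos.2 h0
    have key := mul_abs_le_gammaEnergy (ω := fun i => x i / √(lenSq x)) (by
      rw [lenSq]
      simp only [div_pow, ← add_div]
      rw [Real.sq_sqrt (lenSq_nonneg x)]
      exact div_self h0.ne') hR hu hs t
    simpa only [mul_div_cancel₀ _ hR.ne'] using key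
  calc √(1 + lenSq x) * |u (Fin.cons t x)| ≤ (1 + √(lenSq x)) * |u (Fin.cons t x)| := by gcongr
    _ = |u (Fin.cons t x)| + √(lenSq x) * |u (Fin.cons t x)| := by ring
    _ ≤ _ := (add_le_add (abs_le_gammaEnergy hu hs t x) hfar).trans_eq (by ring)

theorem gammaEnergy_pd_opIter_le {w : (Fin 4 → ℝ) → ℝ} (hw : ContDiff ℝ (⊤ : ℕ∞) w)
    (hs : HasCompactSupport w) (t : ℝ) (L : List (Fin 10)) (i : Fin 4) :
    gammaEnergy 3 (fun _ : Unit => pd i (opIter GammaField L w)) t ≤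
      111 * (2 ^ L.length * gammaEnergy (L.length + 3) (fun j => pd j w) t) := by
  set E := 2 ^ L.length * gammaEnergy (L.length + 3) (fun j => pd j w) t
  calc gammaEnergy 3 (fun _ : Unit => pd i (opIter GammaField L w)) t
      ≤ ∑ n ∈ Finset.range 3, ∑ _σ : Fin n → Fin 10, ∑ _j : Unit, E := by
        refine Finset.sum_le_sum fun n hn => Finset.sum_le_sum fun σ _ =>
          Finset.sum_le_sum fun _ _ => ?_
        refine L2x_opIter_pd_opIter_le hw hs t _ L _ i ?_
        rw [List.length_ofFn]
        have := Finset.mem_range.1 hn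
        omega
    _ = 111 * E := by simp [Finset.sum_range_succ]; ring

/-- weighted Sobolev estimate of Klainerman–Sideris type: for every
multi-index length `m` there is a constant `C` such that for every `w ∈ C₀^∞(ℝ₊×ℝ³)`, every
product `Γ^α` of `|α| ≤ m` vector fields from `Γ`, every `t ≥ 0` and `x ∈ ℝ³`,
`⟨r⟩ |∂Γ^α w(t,x)| ≤ C Σ_{|β|≤|α|+2} ‖Γ^β ∂w(t,·)‖_{L²(ℝ³)}`. -/
theorem stmt3 (m : ℕ) :
    ∃ C : ℝ, 0 < C ∧
      ∀ w : (Fin 4 → ℝ) → ℝ, ContDiff ℝ (⊤ : ℕ∞) w → HasCompactSupport w →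
        ∀ L : List (Fin 10), L.length ≤ m →
          ∀ t : ℝ, 0 ≤ t → ∀ x : Fin 3 → ℝ, ∀ i : Fin 4,
            Real.sqrt (1 + ((x 0)^2 + (x 1)^2 + (x 2)^2)) *
                |pd i (opIter GammaField L w) (Fin.cons t x)| ≤
              C * ∑ n ∈ Finset.range (L.length + 3), ∑ σ : Fin n → Fin 10, ∑ j : Fin 4,
                L2x (opIter GammaField (List.ofFn σ) (pd j w)) t := by
  refine ⟨(640 + 640 * 72 ^ 2 * √8) * (111 * 2 ^ m), by positivity,
    fun w hw hs L hL t _ x i => ?_⟩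
  have hE : 0 ≤ gammaEnergy (L.length + 3) (fun j => pd j w) t := gammaEnergy_nonneg _ _ _
  calc _ ≤ (640 + 640 * 72 ^ 2 * √8) *
        gammaEnergy 3 (fun _ : Unit => pd i (opIter GammaField L w)) t :=
        sqrt_mul_abs_le_gammaEnergy (contDiff_pd (contDiff_opIter_GammaField hw L) i)
          (hasCompactSupport_pd (hasCompactSupport_opIter_GammaField hs L) i) t x
    _ ≤ (640 + 640 * 72 ^ 2 * √8) *
        (111 * (2 ^ m * gammaEnergy (L.length + 3) (fun j => pd j w) t)) := by
        gcongr
        refine (gammaEnergy_pd_opIter_le hw hs t L i).trans ?_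
        gcongr
        norm_num
    _ = (640 + 640 * 72 ^ 2 * √8) * (111 * 2 ^ m) *
        gammaEnergy (L.length + 3) (fun j => pd j w) t := by ring
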